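/- Let 𝒞 be a Cartan scheme with a root system ℛ of type 𝒞 such that Δ^Z is finite for every Z ∈ 𝒳. Fix X ∈ 𝒳 and let M := |Δ^X_+|. Let w_0 <_D w_1 <_D ⋯ <_D w_k be a maximal chain in (Hom(𝒲,X), ≤_D), i.e., a chain that is not a proper subchain of any longer chain. Then w_0 = id_X (the morphism of the empty word based at X), k = M, w_M has maximal length in Hom(𝒲,X), and there exist i_1,…,i_M ∈ I such that (i_1,…,i_M) is a reduced expression of w_M and, for each 1 ≤ j ≤ M, (i_1,…,i_j) is a reduced expression of w_j. -/

import Mathlib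

noncomputable section

open scoped BigOperators

namespace WeylGpd

/-- A Cartan scheme: objects `X`, reflection maps `r_i`, and generalized Cartan matrices `A^X`
with `a^{r_i(X)}_{ij} = a^X_{ij}`. -/
structure CartanScheme (n : ℕ) where
  X : Type
  nonempty : Nonempty X
  r : Fin n → X → X
  r_invol : ∀ i x, r i (r i x) = x
  A : X → Matrix (Fin n) (Fin n) ℤ
  A_diag : ∀ x i, A x i i = 2
  A_nonpos : ∀ x i j, i ≠ j → A x i j ≤ 0
  A_zero_iff : ∀ x i j, A x i j = 0 ↔ A x j i = 0
  A_r : ∀ x i j, A (r i x) i j = A x i j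

variable {n : ℕ}

/-- The standard basis vector `α_i` of `ℤ^I`. -/
def alphav (n : ℕ) (i : Fin n) : Fin n → ℤ := Pi.single i 1

/-- The vectors with all coordinates nonnegative. -/
def Epos (n : ℕ) : Set (Fin n → ℤ) := {v | ∀ i, 0 ≤ v i}

/-- The reflection `s_i^X`, `s_i^X(α_j) = α_j − a^X_{ij} α_i`, extended linearly. -/
def sMap (C : CartanScheme n) (i : Fin n) (x : C.X) (v : Fin n → ℤ) : Fin n → ℤ :=
  v - (∑ j, C.A x i j * v j) • alphav n i

/-- The endpoint `X_{m+1}` of a word `(i_1, …, i_m)` based at `x`. -/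
def wordEnd (C : CartanScheme n) : C.X → List (Fin n) → C.X
  | x, [] => x
  | x, (i :: w) => wordEnd C (C.r i x) w

/-- The automorphism `s_{i_1}^{X_1} ∘ ⋯ ∘ s_{i_m}^{X_m}` of a word based at `x`. -/
def wordMap (C : CartanScheme n) : C.X → List (Fin n) → (Fin n → ℤ) → (Fin n → ℤ)
  | _, [] => id
  | x, (i :: w) => sMap C i x ∘ wordMap C (C.r i x) w

/-- The roots `β_j = s_{i_1} ⋯ s_{i_{j-1}} (α_{i_j})` of a word based at `x` (0-indexed). -/
def wordRoot (C : CartanScheme n) (x : C.X) (w : List (Fin n)) (j : Fin w.length) :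
    Fin n → ℤ :=
  wordMap C x (w.take j) (alphav n (w.get j))

/-- A root system of type `𝒞`. -/
structure RootSystem (C : CartanScheme n) where
  Δ : C.X → Set (Fin n → ℤ)
  pos_neg : ∀ x, Δ x = (Δ x ∩ Epos n) ∪ (-(Δ x ∩ Epos n))
  simple : ∀ x i, Δ x ∩ {v | ∃ m : ℤ, v = m • alphav n i} = {alphav n i, -alphav n i}
  s_invariant : ∀ x i, sMap C i x '' Δ x = Δ (C.r i x)
  rank_two_finite : ∀ x i j, i ≠ j →
    (Δ x ∩ {v | ∃ a b : ℕ, v = (a : ℤ) • alphav n i + (b : ℤ) • alphav n j}).Finite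
  rank_two : ∀ x i j, i ≠ j →
    ((C.r i) ∘ (C.r j))^[(Δ x ∩
      {v | ∃ a b : ℕ, v = (a : ℤ) • alphav n i + (b : ℤ) • alphav n j}).ncard] x = x

/-- Positive roots at `x`. -/
def RootSystem.pos {C : CartanScheme n} (R : RootSystem C) (x : C.X) : Set (Fin n → ℤ) :=
  R.Δ x ∩ Epos n

/-- `(φ, (y, x))` is realized by the word `w` based at `x` with endpoint `y`. -/
def IsWord (C : CartanScheme n) (x y : C.X) (φ : (Fin n → ℤ) → (Fin n → ℤ))
    (w : List (Fin n)) : Prop :=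
  wordEnd C x w = y ∧ wordMap C x w = φ

/-- `(φ, (y, x))` is a morphism of the Weyl groupoid, i.e. `Hom(y, x) ∋ φ`. -/
def IsHom (C : CartanScheme n) (x y : C.X) (φ : (Fin n → ℤ) → (Fin n → ℤ)) : Prop :=
  ∃ w : List (Fin n), IsWord C x y φ w

/-- The length `ℓ(w)` of a morphism. -/
def hlen (C : CartanScheme n) (x y : C.X) (φ : (Fin n → ℤ) → (Fin n → ℤ)) : ℕ :=
  sInf {m | ∃ w : List (Fin n), w.length = m ∧ IsWord C x y φ w}

/-- `w` is a reduced expression of the morphism `(φ, (y, x))`. -/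
def IsReduced (C : CartanScheme n) (x y : C.X) (φ : (Fin n → ℤ) → (Fin n → ℤ))
    (w : List (Fin n)) : Prop :=
  IsWord C x y φ w ∧ w.length = hlen C x y φ

/-- `R_w = {α ∈ Δ^X_+ : w^{-1}(α) ∈ Δ^Y_-}`, phrased as `α = w(δ)` for a negative root `δ`. -/
def Rset (C : CartanScheme n) (R : RootSystem C) (x y : C.X)
    (φ : (Fin n → ℤ) → (Fin n → ℤ)) : Set (Fin n → ℤ) :=
  {α | α ∈ R.pos x ∧ ∃ γ ∈ R.pos y, φ (-γ) = α}

end WeylGpd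

namespace WeylGpd

/-- A morphism of the Weyl groupoid with target `x`: an element of `Hom(𝒲, X)`. -/
structure Mor {n : ℕ} (C : CartanScheme n) (x : C.X) where
  src : C.X
  φ : (Fin n → ℤ) → (Fin n → ℤ)
  isHom : IsHom C x src φ

/-- The (right) Duflo order on `Hom(𝒲, X)`: `u ≤_D w` iff `w = u ∘ v` for some morphism `v` with
`ℓ(w) = ℓ(u) + ℓ(v)`. -/
def dufloLE {n : ℕ} (C : CartanScheme n) (x : C.X) (u w : Mor C x) : Prop :=
  ∃ ψ : (Fin n → ℤ) → (Fin n → ℤ), IsHom C u.src w.src ψ ∧ w.φ = u.φ ∘ ψ ∧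
    hlen C x w.src w.φ = hlen C x u.src u.φ + hlen C u.src w.src ψ

/-- Strict Duflo order. -/
def dufloLT {n : ℕ} (C : CartanScheme n) (x : C.X) (u w : Mor C x) : Prop :=
  dufloLE C x u w ∧ u ≠ w

section Words

variable (C : CartanScheme n)

theorem isLinearMap_sMap (i : Fin n) (x : C.X) : IsLinearMap ℤ (sMap C i x) where
  map_add u v := by
    ext k
    simp only [sMap, Pi.add_apply, Pi.sub_apply, Pi.smul_apply, smul_eq_mul, mul_add,
      Finset.sum_add_distrib]
    ring
  map_smul c v := by
    ext k
    have : ∑ j, C.A x i j * (c * v j) = c * ∑ j, C.A x i j * v j := by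
      rw [Finset.mul_sum]
      exact Finset.sum_congr rfl fun j _ => by ring
    simp only [sMap, Pi.sub_apply, Pi.smul_apply, smul_eq_mul, this]
    ring

theorem sMap_apply_of_ne {i k : Fin n} (h : k ≠ i) (x : C.X) (v : Fin n → ℤ) :
    sMap C i x v k = v k := by
  simp [sMap, alphav, h]

theorem sMap_alphav (i j : Fin n) (x : C.X) :
    sMap C i x (alphav n j) = alphav n j - C.A x i j • alphav n i := by
  simp [sMap, alphav, Pi.single_apply]

theorem sMap_alphav_self (i : Fin n) (x : C.X) :
    sMap C i x (alphav n i) = -alphav n i := by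
  rw [sMap_alphav, C.A_diag, two_smul]
  abel

theorem sMap_r (i : Fin n) (x : C.X) : sMap C i (C.r i x) = sMap C i x := by
  funext v
  simp [sMap, C.A_r]

theorem sMap_sMap (i : Fin n) (x : C.X) (v : Fin n → ℤ) :
    sMap C i x (sMap C i x v) = v := by
  conv_lhs => rw [show sMap C i x v = v - (∑ j, C.A x i j * v j) • alphav n i from rfl]
  rw [(isLinearMap_sMap C i x).map_sub, (isLinearMap_sMap C i x).map_smul, sMap_alphav_self]
  simp [sMap]

theorem wordEnd_append (x : C.X) (u v : List (Fin n)) :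
    wordEnd C x (u ++ v) = wordEnd C (wordEnd C x u) v := by
  induction u generalizing x with
  | nil => rfl
  | cons i u ih => exact ih _

theorem wordMap_append (x : C.X) (u v : List (Fin n)) :
    wordMap C x (u ++ v) = wordMap C x u ∘ wordMap C (wordEnd C x u) v := by
  induction u generalizing x with
  | nil => rfl
  | cons i u ih => simp only [List.cons_append, wordMap, wordEnd, ih, Function.comp_assoc]

theorem isLinearMap_wordMap (x : C.X) (w : List (Fin n)) : IsLinearMap ℤ (wordMap C x w) := by
  induction w generalizing x with
  | nil => exact (LinearMap.id : (Fin n → ℤ) →ₗ[ℤ] (Fin n → ℤ)).isLinear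
  | cons i w ih =>
    exact ((isLinearMap_sMap C i x).mk' _ ∘ₗ (ih (C.r i x)).mk' _).isLinear

theorem wordEnd_reverse (x : C.X) (w : List (Fin n)) :
    wordEnd C (wordEnd C x w) w.reverse = x := by
  induction w generalizing x with
  | nil => rfl
  | cons i w ih =>
    rw [List.reverse_cons, wordEnd_append,
      show wordEnd C x (i :: w) = wordEnd C (C.r i x) w from rfl, ih]
    exact C.r_invol i x

theorem wordMap_wordMap_reverse (x : C.X) (w : List (Fin n)) (v : Fin n → ℤ) :
    wordMap C x w (wordMap C (wordEnd C x w) w.reverse v) = v := by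
  induction w generalizing x v with
  | nil => rfl
  | cons i w ih =>
    rw [List.reverse_cons, wordMap_append,
      show wordEnd C x (i :: w) = wordEnd C (C.r i x) w from rfl, wordEnd_reverse]
    simp only [wordMap, Function.comp_apply, id, ih, sMap_r, sMap_sMap]

theorem wordMap_reverse_wordMap (x : C.X) (w : List (Fin n)) (v : Fin n → ℤ) :
    wordMap C (wordEnd C x w) w.reverse (wordMap C x w v) = v := by
  have := wordMap_wordMap_reverse C (wordEnd C x w) w.reverse v
  rwa [wordEnd_reverse, List.reverse_reverse] at this

theorem wordMap_injective (x : C.X) (w : List (Fin n)) :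
    Function.Injective (wordMap C x w) :=
  Function.LeftInverse.injective (wordMap_reverse_wordMap C x w)

/-- A word with letters in `J` only changes coordinates in `J`. -/
theorem wordMap_apply_of_notMem {J : Set (Fin n)} (x : C.X) {w : List (Fin n)}
    (hw : ∀ i ∈ w, i ∈ J) (v : Fin n → ℤ) {k : Fin n} (hk : k ∉ J) :
    wordMap C x w v k = v k := by
  induction w generalizing x with
  | nil => rfl
  | cons i w ih =>
    have hki : k ≠ i := fun h => hk (h ▸ hw i (by simp))
    simp only [wordMap, Function.comp_apply]
    rw [sMap_apply_of_ne C hki, ih _ fun l hl => hw l (by simp [hl])]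

end Words

theorem eq_sum_smul_alphav (v : Fin n → ℤ) : v = ∑ l, v l • alphav n l := by
  ext k
  simp [alphav, Pi.single_apply]

theorem alphav_mem_Epos (i : Fin n) : alphav n i ∈ Epos n := by
  intro k
  by_cases h : k = i <;> simp [alphav, h]

/-- A linear map that is nonnegative on the simple roots in `J` is nonnegative on the cone they
span. -/
theorem map_mem_Epos {f : (Fin n → ℤ) → (Fin n → ℤ)} (hf : IsLinearMap ℤ f)
    {J : Set (Fin n)} (hJ : ∀ l ∈ J, f (alphav n l) ∈ Epos n) {v : Fin n → ℤ}
    (hv : v ∈ Epos n) (hvJ : ∀ l ∉ J, v l = 0) : f v ∈ Epos n := by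
  intro k
  have : f v = ∑ l, v l • f (alphav n l) := by
    conv_lhs => rw [eq_sum_smul_alphav v]
    refine (map_sum (hf.mk' f) (fun l => v l • alphav n l) Finset.univ).trans ?_
    exact Finset.sum_congr rfl fun l _ => hf.map_smul _ _
  rw [this, Finset.sum_apply]
  refine Finset.sum_nonneg fun l _ => ?_
  by_cases hl : l ∈ J
  · exact mul_nonneg (hv l) (hJ l hl k)
  · simp [hvJ l hl]

namespace RootSystem

variable {C : CartanScheme n} (R : RootSystem C)

theorem alphav_mem (x : C.X) (i : Fin n) : alphav n i ∈ R.Δ x := by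
  have : alphav n i ∈ R.Δ x ∩ {v | ∃ m : ℤ, v = m • alphav n i} := by
    rw [R.simple]
    simp
  exact this.1

theorem alphav_mem_pos (x : C.X) (i : Fin n) : alphav n i ∈ R.pos x :=
  ⟨R.alphav_mem x i, alphav_mem_Epos i⟩

theorem mem_Epos_or {x : C.X} {v : Fin n → ℤ} (hv : v ∈ R.Δ x) : v ∈ Epos n ∨ -v ∈ Epos n := by
  rw [R.pos_neg] at hv
  exact hv.imp And.right And.right

theorem ne_zero [NeZero n] {x : C.X} {v : Fin n → ℤ} (hv : v ∈ R.Δ x) : v ≠ 0 := by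
  rintro rfl
  have : (0 : Fin n → ℤ) ∈ R.Δ x ∩ {v | ∃ m : ℤ, v = m • alphav n 0} := ⟨hv, 0, by simp⟩
  rw [R.simple] at this
  have h1 : alphav n 0 = 0 := by
    rcases this with h | h
    · exact h.symm
    · exact neg_eq_zero.1 (Set.mem_singleton_iff.1 h).symm
  simpa [alphav] using congrFun h1 0

theorem not_both_mem_Epos {v : Fin n → ℤ} (hv : v ≠ 0) (h : v ∈ Epos n) (h' : -v ∈ Epos n) :
    False :=
  hv (funext fun k => le_antisymm (by simpa using h' k) (h k))

theorem sMap_mem {x : C.X} {v : Fin n → ℤ} (i : Fin n) (hv : v ∈ R.Δ x) :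
    sMap C i x v ∈ R.Δ (C.r i x) :=
  R.s_invariant x i ▸ Set.mem_image_of_mem _ hv

theorem wordMap_mem (x : C.X) (w : List (Fin n)) {v : Fin n → ℤ}
    (hv : v ∈ R.Δ (wordEnd C x w)) : wordMap C x w v ∈ R.Δ x := by
  induction w generalizing x with
  | nil => exact hv
  | cons i w ih =>
    have := R.sMap_mem i (ih (C.r i x) hv)
    rwa [C.r_invol, sMap_r] at this

/-- The simple reflection `s_i` permutes the positive roots other than `α_i`. -/
theorem sMap_mem_pos {x : C.X} {v : Fin n → ℤ} {i : Fin n} (hv : v ∈ R.pos x)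
    (hi : v ≠ alphav n i) : sMap C i x v ∈ R.pos (C.r i x) := by
  refine ⟨R.sMap_mem i hv.1, ?_⟩
  rcases R.mem_Epos_or (R.sMap_mem i hv.1) with h | h
  · exact h
  exfalso
  have hz : ∀ k, k ≠ i → v k = 0 := fun k hk => by
    have h1 := h k
    rw [Pi.neg_apply, sMap_apply_of_ne C hk] at h1
    have h2 := hv.2 k
    omega
  have hvi : v = v i • alphav n i := by
    ext k
    by_cases hk : k = i
    · subst hk; simp [alphav]
    · simp [alphav, hk, hz k hk]
  have : v ∈ R.Δ x ∩ {v | ∃ m : ℤ, v = m • alphav n i} := ⟨hv.1, v i, hvi⟩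
  rw [R.simple] at this
  rcases this with h' | h'
  · exact hi h'
  · have h2 := hv.2 i
    rw [Set.mem_singleton_iff.1 h'] at h2
    simp [alphav] at h2

/-- The positive roots supported in `J`. -/
def posOn (J : Set (Fin n)) (x : C.X) : Set (Fin n → ℤ) :=
  {v | v ∈ R.pos x ∧ ∀ l ∉ J, v l = 0}

/-- The positive roots at `y` supported in `J` that `φ` makes negative. -/
def inv (J : Set (Fin n)) (y : C.X) (φ : (Fin n → ℤ) → (Fin n → ℤ)) : Set (Fin n → ℤ) :=
  {v | v ∈ R.posOn J y ∧ -φ v ∈ Epos n}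

theorem alphav_mem_posOn {J : Set (Fin n)} {i : Fin n} (hi : i ∈ J) (x : C.X) :
    alphav n i ∈ R.posOn J x :=
  ⟨R.alphav_mem_pos x i, fun l hl => by
    simp [alphav, show l ≠ i from fun h => hl (h ▸ hi)]⟩

theorem alphav_mem_inv {J : Set (Fin n)} {i : Fin n} (hi : i ∈ J) {x : C.X}
    {φ : (Fin n → ℤ) → (Fin n → ℤ)} :
    alphav n i ∈ R.inv J x φ ↔ -φ (alphav n i) ∈ Epos n :=
  ⟨And.right, fun h => ⟨R.alphav_mem_posOn hi x, h⟩⟩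

theorem posOn_univ (x : C.X) : R.posOn Set.univ x = R.pos x := by
  simp [posOn]

theorem image_posOn {J : Set (Fin n)} {i : Fin n} (hi : i ∈ J) (x : C.X) :
    sMap C i x '' (R.posOn J x \ {alphav n i}) = R.posOn J (C.r i x) \ {alphav n i} := by
  have key : ∀ y : C.X, ∀ v ∈ R.posOn J y \ {alphav n i},
      sMap C i y v ∈ R.posOn J (C.r i y) \ {alphav n i} := by
    intro y v hv
    refine ⟨⟨R.sMap_mem_pos hv.1.1 hv.2, fun l hl => ?_⟩, fun h => ?_⟩
    · rw [sMap_apply_of_ne C (fun h : l = i => hl (h ▸ hi)), hv.1.2 l hl]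
    · have h1 := congrArg (sMap C i y) (Set.mem_singleton_iff.1 h)
      rw [sMap_sMap, sMap_alphav_self] at h1
      have h2 := hv.1.1.2 i
      rw [h1] at h2
      simp [alphav] at h2
  refine Set.Subset.antisymm ?_ fun v hv => ?_
  · rintro _ ⟨v, hv, rfl⟩
    exact key x v hv
  · have := key _ v hv
    rw [C.r_invol, sMap_r] at this
    exact ⟨_, this, sMap_sMap C i x v⟩

variable {R}

theorem finite_posOn (hfin : ∀ z : C.X, (R.Δ z).Finite) (J : Set (Fin n)) (x : C.X) :
    (R.posOn J x).Finite :=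
  (hfin x).subset fun _ hv => hv.1.1

theorem ncard_posOn_r (hfin : ∀ z : C.X, (R.Δ z).Finite) {J : Set (Fin n)} {i : Fin n}
    (hi : i ∈ J) (x : C.X) :
    (R.posOn J (C.r i x)).ncard = (R.posOn J x).ncard := by
  have h3 := Set.ncard_image_of_injective (R.posOn J x \ {alphav n i})
    (Function.LeftInverse.injective (sMap_sMap C i x))
  rw [R.image_posOn hi] at h3
  have h1 := Set.ncard_sdiff_singleton_add_one (R.alphav_mem_posOn hi x) (finite_posOn hfin J x)
  have h2 := Set.ncard_sdiff_singleton_add_one (R.alphav_mem_posOn hi (C.r i x))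
    (finite_posOn hfin J _)
  omega

theorem ncard_posOn_wordEnd (hfin : ∀ z : C.X, (R.Δ z).Finite) {J : Set (Fin n)} (x : C.X)
    {w : List (Fin n)} (hw : ∀ i ∈ w, i ∈ J) :
    (R.posOn J (wordEnd C x w)).ncard = (R.posOn J x).ncard := by
  induction w generalizing x with
  | nil => rfl
  | cons i w ih =>
    rw [← ncard_posOn_r hfin (hw i (by simp)) x]
    exact ih _ fun l hl => hw l (by simp [hl])

/-- The word `w` based at `x` makes the simple root `α_i` negative. -/
def IsDescent (C : CartanScheme n) (x : C.X) (w : List (Fin n)) (i : Fin n) : Prop :=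
  -wordMap C x w (alphav n i) ∈ Epos n

/-- The number of positive roots supported in `J` that the word `w` makes negative. -/
def invCard (R : RootSystem C) (J : Set (Fin n)) (x : C.X) (w : List (Fin n)) : ℕ :=
  (R.inv J (wordEnd C x w) (wordMap C x w)).ncard

theorem finite_inv (hfin : ∀ z : C.X, (R.Δ z).Finite) (J : Set (Fin n)) (y : C.X)
    (φ : (Fin n → ℤ) → (Fin n → ℤ)) : (R.inv J y φ).Finite :=
  (finite_posOn hfin J y).subset fun _ hv => hv.1

theorem mem_Epos_of_not_isDescent (R : RootSystem C) {x : C.X} {w : List (Fin n)} {i : Fin n}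
    (h : ¬ IsDescent C x w i) : wordMap C x w (alphav n i) ∈ Epos n :=
  (R.mem_Epos_or (R.wordMap_mem x w (R.alphav_mem _ i))).resolve_right h

theorem not_isDescent_of_mem_Epos {x : C.X} {w : List (Fin n)} {i : Fin n}
    (h : wordMap C x w (alphav n i) ∈ Epos n) : ¬ IsDescent C x w i := by
  intro h'
  have h0 : wordMap C x w (alphav n i) = 0 :=
    funext fun k => le_antisymm (by simpa using h' k) (h k)
  have h1 := wordMap_injective C x w (h0.trans (isLinearMap_wordMap C x w).map_zero.symm)
  simpa [alphav] using congrFun h1 i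

theorem wordMap_concat_alphav (x : C.X) (w : List (Fin n)) (i : Fin n) :
    wordMap C x (w ++ [i]) (alphav n i) = -wordMap C x w (alphav n i) := by
  rw [wordMap_append]
  simp only [wordMap, Function.comp_apply, id]
  rw [sMap_alphav_self, (isLinearMap_wordMap C x w).map_neg]

theorem isDescent_concat (R : RootSystem C) {x : C.X} {w : List (Fin n)} {i : Fin n} :
    IsDescent C x (w ++ [i]) i ↔ ¬ IsDescent C x w i := by
  rw [IsDescent, wordMap_concat_alphav, neg_neg]
  exact ⟨not_isDescent_of_mem_Epos, mem_Epos_of_not_isDescent R⟩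

theorem inv_concat_diff (R : RootSystem C) {J : Set (Fin n)} {i : Fin n} (hi : i ∈ J) (x : C.X)
    (w : List (Fin n)) :
    R.inv J (wordEnd C x (w ++ [i])) (wordMap C x (w ++ [i])) \ {alphav n i} =
      sMap C i (wordEnd C x w) ''
        (R.inv J (wordEnd C x w) (wordMap C x w) \ {alphav n i}) := by
  rw [wordEnd_append, wordMap_append]
  set y := wordEnd C x w
  have h := R.image_posOn hi y
  ext v
  constructor
  · rintro ⟨⟨hv, hv'⟩, hne⟩
    obtain ⟨u, hu, rfl⟩ : v ∈ sMap C i y '' (R.posOn J y \ {alphav n i}) := h ▸ ⟨hv, hne⟩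
    refine ⟨u, ⟨⟨hu.1, ?_⟩, hu.2⟩, rfl⟩
    simpa [wordMap, sMap_sMap] using hv'
  · rintro ⟨u, ⟨⟨hu, hu'⟩, hne⟩, rfl⟩
    have h1 : sMap C i y u ∈ R.posOn J (C.r i y) \ {alphav n i} := h ▸ ⟨u, ⟨hu, hne⟩, rfl⟩
    refine ⟨⟨h1.1, ?_⟩, h1.2⟩
    simpa [wordMap, sMap_sMap] using hu'

theorem ncard_inv_concat_diff (R : RootSystem C) {J : Set (Fin n)} {i : Fin n} (hi : i ∈ J)
    (x : C.X) (w : List (Fin n)) :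
    (R.inv J (wordEnd C x (w ++ [i])) (wordMap C x (w ++ [i])) \ {alphav n i}).ncard =
      (R.inv J (wordEnd C x w) (wordMap C x w) \ {alphav n i}).ncard := by
  rw [inv_concat_diff R hi]
  exact Set.ncard_image_of_injective _ (Function.LeftInverse.injective (sMap_sMap C i _))

theorem invCard_concat_of_not_isDescent (hfin : ∀ z : C.X, (R.Δ z).Finite) {J : Set (Fin n)}
    {i : Fin n} (hi : i ∈ J) {x : C.X} {w : List (Fin n)} (h : ¬ IsDescent C x w i) :
    R.invCard J x (w ++ [i]) = R.invCard J x w + 1 := by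
  have h1 := ncard_inv_concat_diff R hi x w
  rw [Set.sdiff_singleton_eq_self fun h' => h ((R.alphav_mem_inv hi).1 h')] at h1
  rw [invCard, invCard, ← h1]
  exact (Set.ncard_sdiff_singleton_add_one
    ((R.alphav_mem_inv hi).2 ((isDescent_concat R).2 h)) (finite_inv hfin _ _ _)).symm

theorem invCard_concat_of_isDescent (hfin : ∀ z : C.X, (R.Δ z).Finite) {J : Set (Fin n)}
    {i : Fin n} (hi : i ∈ J) {x : C.X} {w : List (Fin n)} (h : IsDescent C x w i) :
    R.invCard J x (w ++ [i]) + 1 = R.invCard J x w := by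
  have h1 := ncard_inv_concat_diff R hi x w
  rw [Set.sdiff_singleton_eq_self fun h' =>
    (isDescent_concat R).1 ((R.alphav_mem_inv hi).1 h') h] at h1
  rw [invCard, invCard, h1]
  exact Set.ncard_sdiff_singleton_add_one ((R.alphav_mem_inv hi).2 h) (finite_inv hfin _ _ _)

theorem invCard_append_le (hfin : ∀ z : C.X, (R.Δ z).Finite) (x : C.X) (w v : List (Fin n)) :
    R.invCard Set.univ x (w ++ v) ≤ R.invCard Set.univ x w + v.length := by
  induction v using List.reverseRecOn with
  | nil => simp
  | append_singleton v i ih =>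
    rw [← List.append_assoc, List.length_append, List.length_singleton]
    by_cases h : IsDescent C x (w ++ v) i
    · have := invCard_concat_of_isDescent hfin (Set.mem_univ i) h
      omega
    · have := invCard_concat_of_not_isDescent hfin (Set.mem_univ i) h
      omega

theorem invCard_nil [NeZero n] (R : RootSystem C) (J : Set (Fin n)) (x : C.X) :
    R.invCard J x [] = 0 := by
  rw [invCard, show R.inv J (wordEnd C x []) (wordMap C x []) = ∅ from ?_, Set.ncard_empty]
  exact Set.eq_empty_of_forall_notMem fun v hv =>
    not_both_mem_Epos (R.ne_zero hv.1.1.1) hv.1.1.2 hv.2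

theorem not_isDescent_of_invCard_eq_zero (hfin : ∀ z : C.X, (R.Δ z).Finite) {J : Set (Fin n)}
    {x : C.X} {w : List (Fin n)} (h : R.invCard J x w = 0) {i : Fin n} (hi : i ∈ J) :
    ¬ IsDescent C x w i := by
  rw [invCard, Set.ncard_eq_zero (finite_inv hfin _ _ _)] at h
  intro hd
  have : alphav n i ∈ R.inv J (wordEnd C x w) (wordMap C x w) := (R.alphav_mem_inv hi).2 hd
  rw [h] at this
  exact this

theorem neg_wordMap_mem_Epos {J : Set (Fin n)} {x : C.X} {w : List (Fin n)}
    (h : ∀ i ∈ J, IsDescent C x w i) {v : Fin n → ℤ} (hv : v ∈ Epos n)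
    (hvJ : ∀ l ∉ J, v l = 0) : -wordMap C x w v ∈ Epos n :=
  map_mem_Epos (f := fun v => -wordMap C x w v)
    (-(isLinearMap_wordMap C x w).mk' (wordMap C x w)).isLinear h hv hvJ

theorem invCard_eq_ncard_posOn (R : RootSystem C) {J : Set (Fin n)} {x : C.X} {w : List (Fin n)}
    (h : ∀ i ∈ J, IsDescent C x w i) : R.invCard J x w = (R.posOn J (wordEnd C x w)).ncard := by
  rw [invCard]
  congr 1
  exact Set.Subset.antisymm (fun _ hv => hv.1) fun v hv =>
    ⟨hv, neg_wordMap_mem_Epos h hv.1.2 hv.2⟩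

theorem isDescent_of_invCard_eq (hfin : ∀ z : C.X, (R.Δ z).Finite) {J : Set (Fin n)} {x : C.X}
    {w : List (Fin n)} (h : R.invCard J x w = (R.posOn J (wordEnd C x w)).ncard) {i : Fin n}
    (hi : i ∈ J) : IsDescent C x w i := by
  have := Set.eq_of_subset_of_ncard_le (s := R.inv J (wordEnd C x w) (wordMap C x w))
    (fun _ hv => hv.1) h.ge (finite_posOn hfin J _)
  exact (this ▸ R.alphav_mem_posOn hi _ : alphav n i ∈ R.inv J _ _).2

theorem invCard_le_ncard_posOn (hfin : ∀ z : C.X, (R.Δ z).Finite) {J : Set (Fin n)} {x : C.X}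
    {w : List (Fin n)} : R.invCard J x w ≤ (R.posOn J (wordEnd C x w)).ncard :=
  Set.ncard_le_ncard (fun _ hv => hv.1) (finite_posOn hfin J _)

end RootSystem

section RankTwo

open RootSystem

/-- The `k`-th letter (counting from `0`) of the alternating word `a b a b …`. -/
def altLetter (a b : Fin n) (k : ℕ) : Fin n := if Even k then a else b

/-- The alternating word `a b a b …` with `k` letters. -/
def alt (a b : Fin n) : ℕ → List (Fin n)
  | 0 => []
  | k + 1 => alt a b k ++ [altLetter a b k]

theorem altLetter_succ (a b : Fin n) (k : ℕ) : altLetter a b (k + 1) = altLetter b a k := by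
  by_cases h : Even k <;> simp [altLetter, h, Nat.even_add_one]

theorem altLetter_mem (a b : Fin n) (k : ℕ) : altLetter a b k ∈ ({a, b} : Set (Fin n)) := by
  unfold altLetter
  split_ifs <;> simp

theorem altLetter_eq_or {a b i : Fin n} (h : i ∈ ({a, b} : Set (Fin n))) (k : ℕ) :
    i = altLetter a b k ∨ i = altLetter b a k := by
  unfold altLetter
  split_ifs
  · exact h
  · exact h.symm

theorem length_alt (a b : Fin n) (k : ℕ) : (alt a b k).length = k := by
  induction k with
  | zero => rfl
  | succ k ih => simp [alt, ih]

theorem mem_alt {a b i : Fin n} {k : ℕ} (h : i ∈ alt a b k) : i ∈ ({a, b} : Set (Fin n)) := by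
  induction k with
  | zero => simp [alt] at h
  | succ k ih =>
    rcases List.mem_append.1 h with h | h
    · exact ih h
    · exact List.mem_singleton.1 h ▸ altLetter_mem a b k

theorem cons_alt (a b : Fin n) (k : ℕ) : a :: alt b a k = alt a b (k + 1) := by
  induction k with
  | zero => simp [alt, altLetter]
  | succ k ih =>
    rw [show alt b a (k + 1) = alt b a k ++ [altLetter b a k] from rfl, ← List.cons_append, ih,
      ← altLetter_succ]
    rfl

theorem alt_add (a b : Fin n) (k t : ℕ) : ∃ w, alt a b (k + t) = alt a b k ++ w := by
  induction t with
  | zero => exact ⟨[], by simp⟩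
  | succ t ih =>
    obtain ⟨w, hw⟩ := ih
    exact ⟨w ++ [altLetter a b (k + t)], by rw [← List.append_assoc, ← hw]; rfl⟩

theorem alt_append_reverse (a b : Fin n) (k t : ℕ) (h : Even (k + t)) :
    alt a b k ++ (alt b a t).reverse = alt a b (k + t) := by
  induction t generalizing k with
  | zero => simp [alt]
  | succ t ih =>
    have h' : Even (k + 1 + t) := by convert h using 1; ring
    have hl : altLetter b a t = altLetter a b k := by
      have : Even t ↔ ¬ Even k := by
        rw [← add_assoc, Nat.even_add_one, Nat.even_add] at h
        tauto
      by_cases hk : Even k <;> simp [altLetter, this, hk]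
    rw [show k + (t + 1) = k + 1 + t by ring, ← ih (k + 1) h']
    simp [alt, hl]

theorem wordEnd_alt (C : CartanScheme n) (x : C.X) (a b : Fin n) (k : ℕ) :
    wordEnd C x (alt a b (k + k)) = (C.r b ∘ C.r a)^[k] x := by
  induction k with
  | zero => rfl
  | succ k ih =>
    have h : alt a b (k + 1 + (k + 1)) = alt a b (k + k) ++ [a] ++ [b] := by
      rw [show k + 1 + (k + 1) = k + k + 1 + 1 by ring]
      simp [alt, altLetter, Nat.even_add_one]
    rw [h, wordEnd_append, wordEnd_append, ih, Function.iterate_succ_apply']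
    rfl

/-- A nonnegative integral automorphism with nonnegative inverse that only changes the coordinates
`a` and `b`, with determinant `1`, is the identity. -/
theorem eq_self_of_nonneg {a b : Fin n} (hab : a ≠ b) {f g : (Fin n → ℤ) → (Fin n → ℤ)}
    (hf : IsLinearMap ℤ f) (hfg : ∀ v, f (g v) = v)
    (hfp : ∀ l, f (alphav n l) ∈ Epos n) (hgp : ∀ l, g (alphav n l) ∈ Epos n)
    (hfc : ∀ v k, k ∉ ({a, b} : Set (Fin n)) → f v k = v k)
    (hgc : ∀ v k, k ∉ ({a, b} : Set (Fin n)) → g v k = v k)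
    (hdet : f (alphav n a) a * f (alphav n b) b - f (alphav n a) b * f (alphav n b) a = 1)
    (v : Fin n → ℤ) : f v = v := by
  have expand : ∀ (h : (Fin n → ℤ) → (Fin n → ℤ)) (u : Fin n → ℤ),
      (∀ k, k ∉ ({a, b} : Set (Fin n)) → h u k = u k) →
      h u = u + (h u a - u a) • alphav n a + (h u b - u b) • alphav n b := by
    intro h u hu
    ext k
    by_cases hka : k = a
    · subst hka; simp [alphav, hab]
    · by_cases hkb : k = b
      · subst hkb; simp [alphav, hka]
      · simp [alphav, hka, hkb, hu k (by simp [hka, hkb])]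
  have comp : ∀ u k, u k = f u k + (g u a - u a) * f (alphav n a) k
      + (g u b - u b) * f (alphav n b) k := by
    intro u k
    have h1 := congrFun (hfg u) k
    rw [expand g u (hgc u), hf.map_add, hf.map_add, hf.map_smul, hf.map_smul] at h1
    simpa using h1.symm
  have haa : alphav n a a = 1 := by simp [alphav]
  have hbb : alphav n b b = 1 := by simp [alphav]
  have hba : alphav n a b = 0 := by simp [alphav, hab.symm]
  have hab' : alphav n b a = 0 := by simp [alphav, hab]
  have e1 := comp (alphav n a) a
  have e2 := comp (alphav n a) b
  have e3 := comp (alphav n b) a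
  have e4 := comp (alphav n b) b
  rw [haa, hba] at e1 e2
  rw [hbb, hab'] at e3 e4
  have p0 := hfp a a
  have q0 := hfp a b
  have r0 := hfp b a
  have s0 := hfp b b
  have p0' := hgp a a
  have q0' := hgp a b
  have r0' := hgp b a
  have s0' := hgp b b
  have hqr := mul_nonneg q0 r0
  have hps : 0 < f (alphav n a) a * f (alphav n b) b := by linarith
  have hp : 0 < f (alphav n a) a := lt_of_le_of_ne p0 fun h => by simp [← h] at hps
  have hs : 0 < f (alphav n b) b := lt_of_le_of_ne s0 fun h => by simp [← h] at hps
  have hq' : g (alphav n a) b = 0 := by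
    have h1 := mul_nonneg p0' q0
    have h2 := mul_nonneg q0' s0
    have h3 : g (alphav n a) b * f (alphav n b) b = 0 := by linarith
    exact (mul_eq_zero.1 h3).resolve_right hs.ne'
  have hr' : g (alphav n b) a = 0 := by
    have h1 := mul_nonneg s0' r0
    have h2 := mul_nonneg r0' p0
    have h3 : g (alphav n b) a * f (alphav n a) a = 0 := by linarith
    exact (mul_eq_zero.1 h3).resolve_right hp.ne'
  rw [hq'] at e1 e2
  rw [hr'] at e3 e4
  have hp1 : f (alphav n a) a = 1 :=
    Int.eq_one_of_mul_eq_one_left p0 (show g (alphav n a) a * _ = 1 by linarith)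
  have hs1 : f (alphav n b) b = 1 :=
    Int.eq_one_of_mul_eq_one_left s0 (show g (alphav n b) b * _ = 1 by linarith)
  rw [hp1] at e1
  rw [hs1] at e4
  have hq : f (alphav n a) b = 0 := by
    rw [show g (alphav n a) a = 1 by linarith] at e2
    linarith
  have hr : f (alphav n b) a = 0 := by
    rw [show g (alphav n b) b = 1 by linarith] at e3
    linarith
  have basis : ∀ l, f (alphav n l) = alphav n l := by
    intro l
    ext k
    by_cases hk : k ∈ ({a, b} : Set (Fin n))
    swap
    · exact hfc _ _ hk
    by_cases hla : l = a
    · subst hla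
      rcases hk with rfl | rfl
      · rw [hp1, haa]
      · rw [hq, hba]
    by_cases hlb : l = b
    · subst hlb
      rcases hk with rfl | rfl
      · rw [hr, hab']
      · rw [hs1, hbb]
    have ea := comp (alphav n l) a
    have eb := comp (alphav n l) b
    have hla' : alphav n l a = 0 := by simp [alphav, Ne.symm hla]
    have hlb' : alphav n l b = 0 := by simp [alphav, Ne.symm hlb]
    rw [hp1, hr, hla'] at ea
    rw [hs1, hq, hlb'] at eb
    have h1 := hfp l a
    have h2 := hfp l b
    have h3 := hgp l a
    have h4 := hgp l b
    rcases hk with rfl | rfl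
    · rw [hla']; linarith
    · rw [hlb']; linarith
  have : hf.mk' f = LinearMap.id := by
    refine LinearMap.pi_ext' fun l => LinearMap.ext_ring ?_
    exact basis l
  exact congrArg (fun h => h v) this

theorem det_wordMap (C : CartanScheme n) {a b : Fin n} (hab : a ≠ b) (x : C.X)
    {w : List (Fin n)} (hw : ∀ i ∈ w, i ∈ ({a, b} : Set (Fin n))) :
    wordMap C x w (alphav n a) a * wordMap C x w (alphav n b) b -
      wordMap C x w (alphav n a) b * wordMap C x w (alphav n b) a = (-1) ^ w.length := by
  induction w using List.reverseRecOn with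
  | nil => simp [wordMap, alphav, hab, hab.symm]
  | append_singleton w i ih =>
    have ih := ih fun l hl => hw l (by simp [hl])
    have hl := isLinearMap_wordMap C x w
    rw [wordMap_append, List.length_append, List.length_singleton, pow_succ, ← ih]
    simp only [wordMap, Function.comp_apply, id]
    rcases hw i (by simp) with rfl | hi
    · rw [sMap_alphav_self, sMap_alphav, hl.map_neg, hl.map_sub, hl.map_smul]
      simp only [Pi.neg_apply, Pi.sub_apply, Pi.smul_apply, smul_eq_mul]
      ring
    · rw [Set.mem_singleton_iff.1 hi, sMap_alphav_self, sMap_alphav, hl.map_neg, hl.map_sub,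
        hl.map_smul]
      simp only [Pi.neg_apply, Pi.sub_apply, Pi.smul_apply, smul_eq_mul]
      ring

variable {C : CartanScheme n}

theorem wordMap_reverse_append_alphav_mem_Epos (R : RootSystem C) {J : Set (Fin n)} {x : C.X}
    {u v : List (Fin n)} (huJ : ∀ i ∈ u, i ∈ J) (hvJ : ∀ i ∈ v, i ∈ J)
    (hu : ∀ i ∈ J, IsDescent C x u i)
    (hv : ∀ i ∈ J, IsDescent C x v i) (l : Fin n) :
    wordMap C (wordEnd C x v) (v.reverse ++ u) (alphav n l) ∈ Epos n := by
  have hmem : wordMap C (wordEnd C x v) (v.reverse ++ u) (alphav n l) ∈ R.Δ (wordEnd C x v) :=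
    R.wordMap_mem _ _ (R.alphav_mem _ l)
  rcases R.mem_Epos_or hmem with h | h
  · exact h
  exfalso
  by_cases hl : l ∈ J
  · have hsupp : ∀ k ∉ J, (-wordMap C (wordEnd C x v) (v.reverse ++ u) (alphav n l)) k = 0 := by
      intro k hk
      rw [Pi.neg_apply, wordMap_apply_of_notMem C (J := J) _ _ _ hk]
      · simp [alphav, show k ≠ l from fun h => hk (h ▸ hl)]
      · intro i hi
        rcases List.mem_append.1 hi with hi | hi
        · exact hvJ i (List.mem_reverse.1 hi)
        · exact huJ i hi
    have h1 := neg_wordMap_mem_Epos hv h hsupp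
    rw [(isLinearMap_wordMap C x v).map_neg, neg_neg, wordMap_append, wordEnd_reverse,
      Function.comp_apply, wordMap_wordMap_reverse] at h1
    exact not_isDescent_of_mem_Epos h1 (hu l hl)
  · have h1 := h l
    rw [Pi.neg_apply, wordMap_apply_of_notMem C (J := J) _ _ _ hl] at h1
    · simp [alphav] at h1
    · intro i hi
      rcases List.mem_append.1 hi with hi | hi
      · exact hvJ i (List.mem_reverse.1 hi)
      · exact huJ i hi

/-- Two words in `a, b` of the same parity with the same endpoint, both making `α_a` and `α_b`
negative, define the same automorphism. -/
theorem wordMap_eq_of_isDescent (R : RootSystem C) {a b : Fin n} (hab : a ≠ b) {x : C.X}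
    {u v : List (Fin n)} (huJ : ∀ i ∈ u, i ∈ ({a, b} : Set (Fin n)))
    (hvJ : ∀ i ∈ v, i ∈ ({a, b} : Set (Fin n)))
    (hlen : u.length = v.length)
    (hu : ∀ i ∈ ({a, b} : Set (Fin n)), IsDescent C x u i)
    (hv : ∀ i ∈ ({a, b} : Set (Fin n)), IsDescent C x v i) :
    wordMap C x u = wordMap C x v := by
  have hJ : ∀ i ∈ v.reverse ++ u, i ∈ ({a, b} : Set (Fin n)) := fun i hi =>
    (List.mem_append.1 hi).elim (fun h => hvJ i (List.mem_reverse.1 h)) (huJ i)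
  have hJ' : ∀ i ∈ u.reverse ++ v, i ∈ ({a, b} : Set (Fin n)) := fun i hi =>
    (List.mem_append.1 hi).elim (fun h => huJ i (List.mem_reverse.1 h)) (hvJ i)
  have key := eq_self_of_nonneg hab
    (f := wordMap C (wordEnd C x v) (v.reverse ++ u))
    (g := wordMap C (wordEnd C x u) (u.reverse ++ v))
    (isLinearMap_wordMap C _ _)
    (fun y => by
      rw [wordMap_append, wordMap_append, wordEnd_reverse, wordEnd_reverse]
      simp only [Function.comp_apply]
      rw [wordMap_wordMap_reverse, wordMap_reverse_wordMap])
    (wordMap_reverse_append_alphav_mem_Epos R huJ hvJ hu hv)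
    (wordMap_reverse_append_alphav_mem_Epos R hvJ huJ hv hu)
    (fun y k hk => wordMap_apply_of_notMem C _ hJ y hk)
    (fun y k hk => wordMap_apply_of_notMem C _ hJ' y hk)
    (by rw [det_wordMap C hab _ hJ]; simp [hlen, ← two_mul])
  funext y
  have h := congrArg (wordMap C x v) (key y)
  rw [wordMap_append, wordEnd_reverse, Function.comp_apply, wordMap_wordMap_reverse] at h
  exact h

theorem invCard_alt [NeZero n] {R : RootSystem C} (hfin : ∀ z : C.X, (R.Δ z).Finite)
    (a b : Fin n) (x : C.X) (k : ℕ) (hk : k ≤ (R.posOn {a, b} x).ncard) :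
    R.invCard {a, b} x (alt a b k) = k := by
  have main : R.invCard {a, b} x (alt a b k) = k ∧
      ∀ t, k = t + 1 → IsDescent C x (alt a b k) (altLetter a b t) := by
    induction k with
    | zero => exact ⟨R.invCard_nil _ x, fun t ht => by omega⟩
    | succ k ih =>
      obtain ⟨h1, h2⟩ := ih (by omega)
      have hnd : ¬ IsDescent C x (alt a b k) (altLetter a b k) := by
        intro hd
        have hall : ∀ i ∈ ({a, b} : Set (Fin n)), IsDescent C x (alt a b k) i := by
          cases k with
          | zero =>
            exact absurd hd (not_isDescent_of_invCard_eq_zero hfin h1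
              (altLetter_mem a b 0))
          | succ t =>
            intro i hi
            rcases altLetter_eq_or hi t with rfl | rfl
            · exact h2 t rfl
            · rwa [← altLetter_succ]
        have h3 := R.invCard_eq_ncard_posOn hall
        rw [ncard_posOn_wordEnd hfin x fun i hi => mem_alt hi] at h3
        omega
      refine ⟨?_, fun t ht => ?_⟩
      · exact (invCard_concat_of_not_isDescent hfin (altLetter_mem a b k) hnd).trans
          (by rw [h1])
      · obtain rfl : k = t := by omega
        exact (isDescent_concat R).2 hnd
  exact main.1

theorem posOn_pair (R : RootSystem C) {a b : Fin n} (hab : a ≠ b) (x : C.X) :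
    R.posOn {a, b} x =
      R.Δ x ∩ {v | ∃ p q : ℕ, v = (p : ℤ) • alphav n a + (q : ℤ) • alphav n b} := by
  ext v
  constructor
  · rintro ⟨⟨h1, h2⟩, h3⟩
    refine ⟨h1, (v a).toNat, (v b).toNat, ?_⟩
    ext k
    rw [Int.toNat_of_nonneg (h2 a), Int.toNat_of_nonneg (h2 b)]
    by_cases hka : k = a
    · subst hka; simp [alphav, hab]
    · by_cases hkb : k = b
      · subst hkb; simp [alphav, hka]
      · simp [alphav, hka, hkb, h3 k (by simp [hka, hkb])]
  · rintro ⟨h1, p, q, rfl⟩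
    refine ⟨⟨h1, fun k => ?_⟩, fun l hl => ?_⟩
    · have h2 := alphav_mem_Epos a k
      have h3 := alphav_mem_Epos b k
      simp only [Pi.add_apply, Pi.smul_apply, smul_eq_mul]
      positivity
    · simp only [Set.mem_insert_iff, Set.mem_singleton_iff, not_or] at hl
      simp [alphav, hl.1, hl.2]

/-- The braid relation of rank two. -/
theorem braid [NeZero n] {R : RootSystem C} (hfin : ∀ z : C.X, (R.Δ z).Finite)
    {a b : Fin n} (hab : a ≠ b) (x : C.X) {m : ℕ} (hm : (R.posOn {a, b} x).ncard = m) :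
    IsWord C x (wordEnd C x (alt b a m)) (wordMap C x (alt b a m)) (alt a b m) := by
  have hend : wordEnd C x (alt a b m) = wordEnd C x (alt b a m) := by
    have h1 := wordEnd_alt C x a b m
    have h2 := R.rank_two x b a hab.symm
    rw [← posOn_pair R hab.symm, Set.pair_comm, hm] at h2
    rw [← alt_append_reverse a b m m ⟨m, rfl⟩, wordEnd_append, h2] at h1
    have h3 := wordEnd_reverse C (wordEnd C x (alt a b m)) (alt b a m).reverse
    rw [h1, List.reverse_reverse] at h3
    exact h3.symm
  have desc : ∀ c d : Fin n, (R.posOn {c, d} x).ncard = m → ∀ i ∈ ({c, d} : Set (Fin n)),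
      IsDescent C x (alt c d m) i := fun c d h i hi =>
    isDescent_of_invCard_eq hfin ((invCard_alt hfin c d x m h.ge).trans <| by
      rw [ncard_posOn_wordEnd hfin x fun i hi => mem_alt hi, h]) hi
  refine ⟨hend, wordMap_eq_of_isDescent R hab (fun i => mem_alt)
    (fun i hi => Set.pair_comm a b ▸ mem_alt hi) ?_ (desc a b hm) ?_⟩
  · rw [length_alt, length_alt]
  · have := desc b a (Set.pair_comm a b ▸ hm)
    rwa [Set.pair_comm] at this

end RankTwo

section Length

open RootSystem

variable {C : CartanScheme n}

/-- Two words based at `x` define the same morphism. -/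
def WordEquiv (C : CartanScheme n) (x : C.X) (u v : List (Fin n)) : Prop :=
  wordEnd C x u = wordEnd C x v ∧ wordMap C x u = wordMap C x v

namespace WordEquiv

variable {x : C.X} {u v w : List (Fin n)}

theorem refl (x : C.X) (u : List (Fin n)) : WordEquiv C x u u := ⟨rfl, rfl⟩

theorem symm (h : WordEquiv C x u v) : WordEquiv C x v u := ⟨h.1.symm, h.2.symm⟩

theorem trans (h : WordEquiv C x u v) (h' : WordEquiv C x v w) : WordEquiv C x u w :=
  ⟨h.1.trans h'.1, h.2.trans h'.2⟩

theorem append_right (h : WordEquiv C x u v) (w : List (Fin n)) :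
    WordEquiv C x (u ++ w) (v ++ w) := by
  simp only [WordEquiv, wordEnd_append, wordMap_append, h.1, h.2, and_self]

theorem append_left (w : List (Fin n)) (h : WordEquiv C (wordEnd C x w) u v) :
    WordEquiv C x (w ++ u) (w ++ v) := by
  simp only [WordEquiv, wordEnd_append, wordMap_append, h.1, h.2, and_self]

theorem invCard_eq (h : WordEquiv C x u v) (R : RootSystem C) (J : Set (Fin n)) :
    R.invCard J x u = R.invCard J x v := by
  simp only [invCard, h.1, h.2]

theorem isDescent_iff (h : WordEquiv C x u v) (i : Fin n) :
    IsDescent C x u i ↔ IsDescent C x v i := by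
  simp only [IsDescent, h.2]

theorem append_pair (x : C.X) (u : List (Fin n)) (i : Fin n) :
    WordEquiv C x (u ++ [i] ++ [i]) u := by
  rw [List.append_assoc]
  refine ⟨?_, ?_⟩
  · rw [wordEnd_append]
    exact C.r_invol i _
  · rw [wordMap_append]
    funext v
    simp [wordMap, sMap_r, sMap_sMap]

end WordEquiv

/-- The word `w` makes as many positive roots negative as it has letters. -/
def IsGeodesic (R : RootSystem C) (x : C.X) (w : List (Fin n)) : Prop :=
  R.invCard Set.univ x w = w.length

theorem invCard_le_length [NeZero n] {R : RootSystem C} (hfin : ∀ z : C.X, (R.Δ z).Finite)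
    (x : C.X) (w : List (Fin n)) : R.invCard Set.univ x w ≤ w.length := by
  have := invCard_append_le hfin x [] w
  rwa [invCard_nil, zero_add] at this

theorem IsGeodesic.of_append [NeZero n] {R : RootSystem C} (hfin : ∀ z : C.X, (R.Δ z).Finite)
    {x : C.X} {u v : List (Fin n)} (h : IsGeodesic R x (u ++ v)) : IsGeodesic R x u := by
  have h1 := invCard_append_le hfin x u v
  have h2 := invCard_le_length hfin x u
  rw [IsGeodesic, List.length_append] at h
  rw [IsGeodesic]
  omega

theorem IsGeodesic.not_isDescent [NeZero n] {R : RootSystem C}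
    (hfin : ∀ z : C.X, (R.Δ z).Finite) {x : C.X} {u : List (Fin n)} {i : Fin n}
    (h : IsGeodesic R x (u ++ [i])) : ¬ IsDescent C x u i := by
  intro hd
  have h1 := invCard_concat_of_isDescent hfin (Set.mem_univ i) hd
  have h2 := invCard_le_length hfin x u
  rw [IsGeodesic, List.length_append, List.length_singleton] at h
  omega

theorem IsGeodesic.concat {R : RootSystem C}
    (hfin : ∀ z : C.X, (R.Δ z).Finite) {x : C.X} {u : List (Fin n)} {i : Fin n}
    (h : IsGeodesic R x u) (hd : ¬ IsDescent C x u i) : IsGeodesic R x (u ++ [i]) := by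
  rw [IsGeodesic, invCard_concat_of_not_isDescent hfin (Set.mem_univ i) hd, h]
  simp

/-- The length of an alternating suffix of a geodesic, preceded by a word that is positive on the
rank two cone and making both simple roots negative, is the number of positive roots of rank two. -/
theorem ncard_posOn_pair_eq [NeZero n] {R : RootSystem C} (hfin : ∀ z : C.X, (R.Δ z).Finite)
    {x : C.X} {a b : Fin n} {g : List (Fin n)} {k : ℕ}
    (hgeo : IsGeodesic R x (g ++ alt a b k))
    (hg : ∀ i ∈ ({a, b} : Set (Fin n)), ¬ IsDescent C x g i)
    (hd : ∀ i ∈ ({a, b} : Set (Fin n)), IsDescent C x (g ++ alt a b k) i) :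
    (R.posOn {a, b} (wordEnd C x g)).ncard = k := by
  set z := wordEnd C x g
  have hgpos : ∀ v ∈ Epos n, (∀ l ∉ ({a, b} : Set (Fin n)), v l = 0) →
      wordMap C x g v ∈ Epos n := fun v hv hvJ =>
    map_mem_Epos (isLinearMap_wordMap C x g)
      (fun l hl => mem_Epos_of_not_isDescent R (hg l hl)) hv hvJ
  have hsupp : ∀ t, ∀ i ∈ ({a, b} : Set (Fin n)), ∀ l ∉ ({a, b} : Set (Fin n)),
      wordMap C z (alt a b t) (alphav n i) l = 0 := fun t i hi l hl => by
    rw [wordMap_apply_of_notMem C z (fun j hj => mem_alt hj) _ hl]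
    simp [alphav, show l ≠ i from fun h => hl (h ▸ hi)]
  have hcomp : ∀ t v, wordMap C x (g ++ alt a b t) v =
      wordMap C x g (wordMap C z (alt a b t) v) := fun t v => by
    rw [wordMap_append]; rfl
  rcases lt_trichotomy k (R.posOn {a, b} z).ncard with hk | hk | hk
  · exfalso
    have hdz : ∀ i ∈ ({a, b} : Set (Fin n)), IsDescent C z (alt a b k) i := by
      intro i hi
      by_contra hn
      refine not_isDescent_of_mem_Epos ?_ (hd i hi)
      rw [hcomp]
      exact hgpos _ (mem_Epos_of_not_isDescent R hn) (hsupp k i hi)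
    have h1 := R.invCard_eq_ncard_posOn hdz
    rw [ncard_posOn_wordEnd hfin z fun i hi => mem_alt hi, invCard_alt hfin a b z k hk.le] at h1
    omega
  · exact hk.symm
  · exfalso
    set m := (R.posOn {a, b} z).ncard with hm
    obtain ⟨w, hw⟩ := alt_add a b (m + 1) (k - (m + 1))
    rw [show m + 1 + (k - (m + 1)) = k by omega, alt] at hw
    rw [hw, ← List.append_assoc, ← List.append_assoc] at hgeo
    refine (hgeo.of_append hfin).not_isDescent hfin ?_
    have hmem := altLetter_mem a b m
    have hdz : IsDescent C z (alt a b m) (altLetter a b m) :=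
      isDescent_of_invCard_eq hfin ((invCard_alt hfin a b z m le_rfl).trans <| by
        rw [ncard_posOn_wordEnd hfin z fun i hi => mem_alt hi]) hmem
    rw [IsDescent, hcomp, ← (isLinearMap_wordMap C x g).map_neg]
    refine hgpos _ hdz fun l hl => ?_
    rw [Pi.neg_apply, hsupp m _ hmem l hl, neg_zero]

/-- The exchange property: a geodesic making `α_j` negative can be rewritten to end in `j`. -/
theorem IsGeodesic.exchange [NeZero n] {R : RootSystem C} (hfin : ∀ z : C.X, (R.Δ z).Finite)
    {x : C.X} {j : Fin n} {v : List (Fin n)} (hv : IsGeodesic R x v) (hj : IsDescent C x v j) :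
    ∃ h, h.length + 1 = v.length ∧ WordEquiv C x (h ++ [j]) v := by
  induction hd : v.length using Nat.strong_induction_on generalizing v j with
  | _ d ih =>
  rcases List.eq_nil_or_concat v with rfl | ⟨v', i, rfl⟩
  · exact absurd hj (not_isDescent_of_invCard_eq_zero hfin (R.invCard_nil Set.univ x)
      (Set.mem_univ j))
  rw [List.concat_eq_append] at *
  set v := v' ++ [i] with hvdef
  have hlen : v'.length + 1 = d := by rw [← hd, hvdef]; simp
  by_cases hij : i = j
  · exact ⟨v', hlen, hij ▸ WordEquiv.refl x _⟩
  let P : ℕ → Prop := fun l => ∃ g a b k, g.length = l ∧ l + (k + 1) = d ∧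
    ({a, b} : Set (Fin n)) = {i, j} ∧ WordEquiv C x (g ++ alt a b (k + 1)) v
  have hP : ∃ l, P l :=
    ⟨v'.length, v', i, j, 0, rfl, hlen, rfl, by simpa [alt, altLetter] using WordEquiv.refl x v⟩
  classical
  obtain ⟨g, a, b, k, hgl, hkd, hJ, heq⟩ := Nat.find_spec hP
  have hmin := fun l hl => Nat.find_min (H := hP) (m := l) hl
  have hab : a ≠ b := by
    rintro rfl
    rw [Set.pair_eq_singleton] at hJ
    have h1 : i ∈ ({a} : Set (Fin n)) := hJ ▸ by simp
    have h2 : j ∈ ({a} : Set (Fin n)) := hJ ▸ by simp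
    exact hij (h1.trans h2.symm)
  have hgeo : IsGeodesic R x (g ++ alt a b (k + 1)) := by
    rw [IsGeodesic, heq.invCard_eq, hv, hd, List.length_append, length_alt]
    omega
  have hg : ∀ l ∈ ({a, b} : Set (Fin n)), ¬ IsDescent C x g l := by
    rintro l (rfl | rfl)
    · refine IsGeodesic.not_isDescent hfin (IsGeodesic.of_append hfin (v := alt b l k) ?_)
      simpa [cons_alt] using hgeo
    · intro hdl
      obtain ⟨h, hhl, hh⟩ := ih g.length (by omega) (hgeo.of_append hfin) hdl rfl
      refine hmin h.length (by omega) ⟨h, l, a, k + 1, rfl, by omega, Set.pair_comm a l ▸ hJ, ?_⟩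
      refine WordEquiv.trans ?_ heq
      rw [← cons_alt l a]
      simpa using hh.append_right (alt a l (k + 1))
  have hdesc : ∀ l ∈ ({a, b} : Set (Fin n)), IsDescent C x (g ++ alt a b (k + 1)) l := by
    intro l hl
    rw [heq.isDescent_iff]
    rw [hJ] at hl
    rcases hl with rfl | rfl
    · exact (isDescent_concat R).2 (hv.not_isDescent hfin)
    · exact hj
  have hm := ncard_posOn_pair_eq hfin hgeo hg hdesc
  have hbraid : WordEquiv C x (g ++ alt b a (k + 1)) v :=
    (WordEquiv.append_left g (braid hfin hab _ hm)).symm.trans heq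
  have hjmem : j ∈ ({a, b} : Set (Fin n)) := hJ ▸ by simp
  rcases altLetter_eq_or hjmem k with rfl | rfl
  · exact ⟨g ++ alt a b k, by rw [List.length_append, length_alt]; omega,
      by rw [List.append_assoc]; exact heq⟩
  · exact ⟨g ++ alt b a k, by rw [List.length_append, length_alt]; omega,
      by rw [List.append_assoc]; exact hbraid⟩

theorem exists_isGeodesic [NeZero n] {R : RootSystem C} (hfin : ∀ z : C.X, (R.Δ z).Finite)
    (x : C.X) (w : List (Fin n)) : ∃ g, IsGeodesic R x g ∧ WordEquiv C x g w := by
  induction w using List.reverseRecOn with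
  | nil => exact ⟨[], R.invCard_nil _ x, WordEquiv.refl x _⟩
  | append_singleton w i ih =>
    obtain ⟨g, hg, hgw⟩ := ih
    by_cases hd : IsDescent C x g i
    · obtain ⟨h, hl, hh⟩ := hg.exchange hfin hd
      refine ⟨h, ?_, ?_⟩
      · refine IsGeodesic.of_append hfin (v := [i]) ?_
        rw [IsGeodesic, hh.invCard_eq, hg, List.length_append, List.length_singleton, hl]
      · exact (WordEquiv.append_pair x h i).symm.trans
          ((hh.append_right [i]).trans (hgw.append_right [i]))
    · exact ⟨g ++ [i], hg.concat hfin hd, hgw.append_right [i]⟩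

/-- The length of a morphism is the number of positive roots it makes negative. -/
theorem hlen_eq_invCard [NeZero n] {R : RootSystem C} (hfin : ∀ z : C.X, (R.Δ z).Finite)
    {x y : C.X} {φ : (Fin n → ℤ) → (Fin n → ℤ)} {w : List (Fin n)} (hw : IsWord C x y φ w) :
    hlen C x y φ = R.invCard Set.univ x w := by
  obtain ⟨rfl, rfl⟩ := hw
  apply le_antisymm
  · obtain ⟨g, hg, hgw⟩ := exists_isGeodesic hfin x w
    exact Nat.sInf_le ⟨g, hg.symm.trans (hgw.invCard_eq R _), hgw⟩
  · refine le_csInf ⟨_, w, rfl, rfl, rfl⟩ ?_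
    rintro _ ⟨u, rfl, hu⟩
    exact (WordEquiv.invCard_eq (C := C) (u := u) (v := w) hu R _).symm.trans_le
      (invCard_le_length hfin x u)

end Length

section Duflo

open RootSystem

variable {C : CartanScheme n}

theorem exists_isReduced {x y : C.X} {φ : (Fin n → ℤ) → (Fin n → ℤ)} (h : IsHom C x y φ) :
    ∃ w, IsReduced C x y φ w := by
  obtain ⟨w, hw⟩ := h
  obtain ⟨u, hu, hu'⟩ := Nat.sInf_mem (s := {m | ∃ w : List (Fin n), w.length = m ∧
    IsWord C x y φ w}) ⟨_, w, rfl, hw⟩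
  exact ⟨u, hu', hu⟩

theorem IsWord.hlen_le {x y : C.X} {φ : (Fin n → ℤ) → (Fin n → ℤ)} {w : List (Fin n)}
    (h : IsWord C x y φ w) : hlen C x y φ ≤ w.length :=
  Nat.sInf_le ⟨w, rfl, h⟩

theorem IsWord.append {x y z : C.X} {φ ψ : (Fin n → ℤ) → (Fin n → ℤ)} {u v : List (Fin n)}
    (hu : IsWord C x y φ u) (hv : IsWord C y z ψ v) : IsWord C x z (φ ∘ ψ) (u ++ v) := by
  obtain ⟨rfl, rfl⟩ := hu
  obtain ⟨rfl, rfl⟩ := hv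
  exact ⟨wordEnd_append C x u v, wordMap_append C x u v⟩

theorem IsHom.comp {x y z : C.X} {φ ψ : (Fin n → ℤ) → (Fin n → ℤ)} (h : IsHom C x y φ)
    (h' : IsHom C y z ψ) : IsHom C x z (φ ∘ ψ) :=
  let ⟨_, hu⟩ := h
  let ⟨_, hv⟩ := h'
  ⟨_, hu.append hv⟩

theorem hlen_comp_le {x y z : C.X} {φ ψ : (Fin n → ℤ) → (Fin n → ℤ)} (h : IsHom C x y φ)
    (h' : IsHom C y z ψ) : hlen C x z (φ ∘ ψ) ≤ hlen C x y φ + hlen C y z ψ := by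
  obtain ⟨u, hu, hul⟩ := exists_isReduced h
  obtain ⟨v, hv, hvl⟩ := exists_isReduced h'
  rw [← hul, ← hvl, ← List.length_append]
  exact (hu.append hv).hlen_le

namespace Mor

variable {x : C.X}

theorem ext {u w : Mor C x} (hsrc : u.src = w.src) (hφ : u.φ = w.φ) : u = w := by
  cases u
  cases w
  cases hsrc
  cases hφ
  rfl

/-- The length of a morphism with target `x`. -/
def len (u : Mor C x) : ℕ := hlen C x u.src u.φ

/-- The identity morphism of `x`. -/
def one (x : C.X) : Mor C x := ⟨x, id, [], rfl, rfl⟩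

/-- The composition of a morphism with the morphism of a word based at its source. -/
def extend (u : Mor C x) (q : List (Fin n)) : Mor C x :=
  ⟨wordEnd C u.src q, u.φ ∘ wordMap C u.src q, u.isHom.comp ⟨q, rfl, rfl⟩⟩

theorem extend_append (u : Mor C x) (p q : List (Fin n)) :
    u.extend (p ++ q) = (u.extend p).extend q :=
  ext (wordEnd_append C u.src p q) (by
    simp only [extend, wordMap_append]
    rfl)

theorem len_extend_le (u : Mor C x) (q : List (Fin n)) :
    (u.extend q).len ≤ u.len + q.length := by
  have h : IsWord C u.src (u.extend q).src (wordMap C u.src q) q := ⟨rfl, rfl⟩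
  exact (hlen_comp_le u.isHom ⟨q, h⟩).trans (Nat.add_le_add_left h.hlen_le _)

theorem len_one : (one x).len = 0 :=
  Nat.le_zero.1 (IsWord.hlen_le (w := []) ⟨rfl, rfl⟩)

theorem eq_one_of_len_eq_zero {u : Mor C x} (h : u.len = 0) : u = one x := by
  obtain ⟨w, ⟨hw, hw'⟩, hl⟩ := exists_isReduced u.isHom
  obtain rfl := List.eq_nil_of_length_eq_zero (hl.trans h)
  exact ext hw.symm hw'.symm

end Mor

variable {x : C.X}

/-- `u ≤_D w` iff `w` extends `u` by a word whose length is the difference of lengths. -/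
theorem dufloLE_iff {u w : Mor C x} :
    dufloLE C x u w ↔ ∃ q : List (Fin n), w = u.extend q ∧ w.len = u.len + q.length := by
  constructor
  · rintro ⟨ψ, hψ, hw, hl⟩
    obtain ⟨q, ⟨hq, rfl⟩, hql⟩ := exists_isReduced hψ
    exact ⟨q, Mor.ext hq.symm hw, hl.trans (by rw [hql]; rfl)⟩
  · rintro ⟨q, rfl, hl⟩
    have hq : IsWord C u.src (u.extend q).src (wordMap C u.src q) q := ⟨rfl, rfl⟩
    refine ⟨_, ⟨q, hq⟩, rfl, le_antisymm (hlen_comp_le u.isHom ⟨q, hq⟩) ?_⟩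
    exact (Nat.add_le_add_left hq.hlen_le _).trans hl.ge

theorem dufloLE_refl (u : Mor C x) : dufloLE C x u u := dufloLE_iff.2 ⟨[], rfl, rfl⟩

theorem dufloLE_trans {u v w : Mor C x} (h : dufloLE C x u v) (h' : dufloLE C x v w) :
    dufloLE C x u w := by
  obtain ⟨p, rfl, hp⟩ := dufloLE_iff.1 h
  obtain ⟨q, rfl, hq⟩ := dufloLE_iff.1 h'
  refine dufloLE_iff.2 ⟨p ++ q, (u.extend_append p q).symm, ?_⟩
  rw [hq, hp, List.length_append, add_assoc]

theorem dufloLT_iff {u w : Mor C x} : dufloLT C x u w ↔ dufloLE C x u w ∧ u.len < w.len := by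
  refine and_congr_right fun h => ⟨fun hne => ?_, ?_⟩
  · obtain ⟨q, rfl, hq⟩ := dufloLE_iff.1 h
    cases q with
    | nil => exact absurd rfl hne
    | cons i q => rw [hq, List.length_cons]; omega
  · rintro hlt rfl
    exact hlt.false

theorem one_dufloLE (u : Mor C x) : dufloLE C x (Mor.one x) u := by
  obtain ⟨w, ⟨hw, hw'⟩, hl⟩ := exists_isReduced u.isHom
  exact dufloLE_iff.2 ⟨w, Mor.ext hw.symm hw'.symm, by rw [Mor.len_one, zero_add]; exact hl.symm⟩

/-- An element comparable with all members of a chain can be inserted into the chain. -/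
theorem exists_insert_chain {α : Type*} {r : α → α → Prop} {k : ℕ} {c : Fin (k + 1) → α}
    (hc : ∀ j j', j < j' → r (c j) (c j')) (a : α) (p : Fin (k + 2))
    (hlt : ∀ j, j.castSucc < p → r (c j) a) (hge : ∀ j, p ≤ j.castSucc → r a (c j)) :
    ∃ c' : Fin (k + 2) → α, (∀ j j', j < j' → r (c' j) (c' j')) ∧ Set.range c ⊆ Set.range c' := by
  refine ⟨p.insertNth a c, fun j j' hjj => ?_, ?_⟩
  · rcases Fin.eq_self_or_eq_succAbove p j with h | ⟨l, rfl⟩ <;>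
    rcases Fin.eq_self_or_eq_succAbove p j' with h' | ⟨l', rfl⟩
    · exact absurd hjj (by rw [h, h']; exact lt_irrefl _)
    · subst h
      simpa using hge l' (Fin.lt_succAbove_iff_le_castSucc _ _ |>.1 hjj)
    · subst h'
      simpa using hlt l (Fin.succAbove_lt_iff_castSucc_lt _ _ |>.1 hjj)
    · simpa using hc l l' (Fin.succAbove_lt_succAbove_iff.1 hjj)
  · rintro _ ⟨j, rfl⟩
    exact ⟨p.succAbove j, by simp⟩

theorem len_le_ncard_pos [NeZero n] {R : RootSystem C} (hfin : ∀ z : C.X, (R.Δ z).Finite)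
    (u : Mor C x) : u.len ≤ (R.pos x).ncard := by
  obtain ⟨w, hw⟩ := u.isHom
  rw [Mor.len, hlen_eq_invCard hfin hw, ← posOn_univ,
    ← ncard_posOn_wordEnd hfin x fun i (_ : i ∈ w) => Set.mem_univ i]
  exact invCard_le_ncard_posOn hfin

theorem exists_len_extend [NeZero n] {R : RootSystem C} (hfin : ∀ z : C.X, (R.Δ z).Finite)
    {u : Mor C x} (hu : u.len < (R.pos x).ncard) : ∃ i, (u.extend [i]).len = u.len + 1 := by
  obtain ⟨w, hw⟩ := u.isHom
  have hlen : u.len = R.invCard Set.univ x w := hlen_eq_invCard hfin hw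
  obtain ⟨i, hi⟩ : ∃ i, ¬ IsDescent C x w i := by
    by_contra! hall
    rw [hlen, R.invCard_eq_ncard_posOn fun i _ => hall i,
      ncard_posOn_wordEnd hfin x fun i _ => Set.mem_univ i, posOn_univ] at hu
    exact hu.false
  refine ⟨i, ?_⟩
  have hwi : IsWord C x (u.extend [i]).src (u.extend [i]).φ (w ++ [i]) :=
    hw.append ⟨rfl, rfl⟩
  rw [Mor.len, hlen_eq_invCard hfin hwi, hlen,
    invCard_concat_of_not_isDescent hfin (Set.mem_univ i) hi]

end Duflo

/-- A maximal chain `w_0 <_D w_1 <_D ⋯ <_D w_k` in `(Hom(𝒲, X), ≤_D)` starts at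
the identity, has `k = M := |Δ^X_+|`, ends at an element of maximal length, and is given by the
prefixes of a single reduced expression `(i_1, …, i_M)` of `w_M`. -/
theorem stmt4 {n : ℕ} (hn : 1 ≤ n) (C : CartanScheme n) (R : RootSystem C)
    (hfin : ∀ z : C.X, (R.Δ z).Finite)
    (x : C.X) (M : ℕ) (hM : (R.pos x).ncard = M)
    (kk : ℕ) (c : Fin (kk + 1) → Mor C x)
    (hchain : ∀ j j' : Fin (kk + 1), j < j' → dufloLT C x (c j) (c j'))
    (hmax : ¬ ∃ (kk' : ℕ) (c' : Fin (kk' + 1) → Mor C x),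
      kk < kk' ∧ (∀ j j' : Fin (kk' + 1), j < j' → dufloLT C x (c' j) (c' j')) ∧
      Set.range c ⊆ Set.range c') :
    (c 0).src = x ∧ (c 0).φ = id ∧ kk = M ∧
    (∀ (z : C.X) (ψ : (Fin n → ℤ) → (Fin n → ℤ)), IsHom C x z ψ →
      hlen C x z ψ ≤ hlen C x (c (Fin.last kk)).src (c (Fin.last kk)).φ) ∧
    (∃ is : List (Fin n), is.length = kk ∧
      ∀ j : Fin (kk + 1), IsReduced C x (c j).src (c j).φ (is.take j)) := by
  have : NeZero n := ⟨by omega⟩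
  have hinsert : ∀ (a : Mor C x) (p : Fin (kk + 2)),
      (∀ j : Fin (kk + 1), j.castSucc < p → dufloLT C x (c j) a) →
      (∀ j : Fin (kk + 1), p ≤ j.castSucc → dufloLT C x a (c j)) → False := fun a p h h' =>
    let ⟨c', hc', hr⟩ := exists_insert_chain hchain a p h h'
    hmax ⟨kk + 1, c', Nat.lt_succ_self _, hc', hr⟩
  have hle : ∀ j j' : Fin (kk + 1), j ≤ j' → dufloLE C x (c j) (c j') := fun j j' h =>
    h.lt_or_eq.elim (fun h => (hchain j j' h).1) fun h => h ▸ dufloLE_refl _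
  have hlenle : ∀ j j' : Fin (kk + 1), j ≤ j' → (c j).len ≤ (c j').len := fun j j' h =>
    h.lt_or_eq.elim (fun h => (dufloLT_iff.1 (hchain j j' h)).2.le) fun h => h ▸ le_rfl
  have hzero : c 0 = Mor.one x := by
    refine Mor.eq_one_of_len_eq_zero (by_contra fun h0 => ?_)
    refine hinsert (Mor.one x) 0 (fun j hj => absurd hj (Fin.not_lt_zero _)) fun j _ => ?_
    refine dufloLT_iff.2 ⟨one_dufloLE _, ?_⟩
    have := hlenle 0 j (Fin.zero_le _)
    rw [Mor.len_one]
    omega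
  have hlast : (c (Fin.last kk)).len = M := by
    refine le_antisymm (hM ▸ len_le_ncard_pos hfin _) (not_lt.1 fun hlt => ?_)
    obtain ⟨i, hi⟩ := exists_len_extend hfin (hM.symm ▸ hlt)
    refine hinsert ((c (Fin.last kk)).extend [i]) (Fin.last _) (fun j _ => ?_) fun j hj =>
      absurd hj (not_le.2 (Fin.castSucc_lt_last j))
    refine dufloLT_iff.2 ⟨dufloLE_trans (hle j _ (Fin.le_last j))
      (dufloLE_iff.2 ⟨[i], rfl, hi⟩), ?_⟩
    have := hlenle j _ (Fin.le_last j)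
    omega
  have hstep : ∀ j : Fin kk, ∃ i, c j.succ = (c j.castSucc).extend [i] ∧
      (c j.succ).len = (c j.castSucc).len + 1 := by
    intro j
    have hlt := hchain j.castSucc j.succ Fin.castSucc_lt_succ
    obtain ⟨q, hq, hql⟩ := dufloLE_iff.1 hlt.1
    rcases q with _ | ⟨i, q⟩
    · exact absurd hq.symm hlt.2
    rcases List.eq_nil_or_concat q with rfl | hne
    · exact ⟨i, hq, hql⟩
    have hpos : 0 < q.length := by
      obtain ⟨q', l, rfl⟩ := hne
      simp
    exfalso
    set a := (c j.castSucc).extend [i] with ha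
    have hqa : c j.succ = a.extend q := by
      rw [hq, ha, ← Mor.extend_append]
      rfl
    have h1 : a.len ≤ (c j.castSucc).len + 1 := Mor.len_extend_le _ _
    have h2 : (c j.succ).len ≤ a.len + q.length := hqa ▸ Mor.len_extend_le _ _
    rw [List.length_cons] at hql
    have hale : dufloLE C x (c j.castSucc) a :=
      dufloLE_iff.2 ⟨[i], rfl, by rw [List.length_singleton]; omega⟩
    have hale' : dufloLE C x a (c j.succ) := dufloLE_iff.2 ⟨q, hqa, by omega⟩
    refine hinsert a j.succ.castSucc (fun l hl => ?_) fun l hl => ?_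
    · have hl' : l ≤ j.castSucc := by
        simp only [Fin.lt_def, Fin.le_def, Fin.val_castSucc, Fin.val_succ] at hl ⊢
        omega
      have := hlenle _ _ hl'
      exact dufloLT_iff.2 ⟨dufloLE_trans (hle _ _ hl') hale, by omega⟩
    · have hl' : j.succ ≤ l := hl
      have := hlenle _ _ hl'
      exact dufloLT_iff.2 ⟨dufloLE_trans hale' (hle _ _ hl'), by omega⟩
  choose i hi hlen using hstep
  have hlenj : ∀ j : Fin (kk + 1), (c j).len = j := by
    intro j
    induction j using Fin.induction with
    | zero => rw [hzero, Mor.len_one]; rfl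
    | succ j ih => rw [hlen, ih]; rfl
  refine ⟨congrArg Mor.src hzero, by rw [hzero]; rfl, ?_, fun z ψ hψ => ?_,
    List.ofFn i, List.length_ofFn, fun j => ?_⟩
  · rw [← hlast, hlenj]
    rfl
  · exact (len_le_ncard_pos hfin ⟨z, ψ, hψ⟩).trans (hM.trans hlast.symm).le
  · refine ⟨?_, ?_⟩
    · induction j using Fin.induction with
      | zero => rw [hzero]; exact ⟨rfl, rfl⟩
      | succ j ih =>
        have htake : (List.ofFn i).take (j.succ : ℕ) =
            (List.ofFn i).take (j.castSucc : ℕ) ++ [i j] := by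
          rw [Fin.val_succ, Fin.val_castSucc, List.take_succ_eq_append_getElem (by simp)]
          simp
        rw [htake, hi]
        exact ih.append ⟨rfl, rfl⟩
    · rw [List.length_take, List.length_ofFn, min_eq_left (Fin.is_le j)]
      exact (hlenj j).symm

end WeylGpd
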